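/- arXiv:2001.03944 — 3 statements merged into one kernel-verified Lean document; each statement's English description precedes it below -/
import Mathlib

section
/- Fix (x_k,λ_k) ∈ ℝⁿ×ℝᵐ and c_k > 0. Let x̄_k be the unique minimizer of ξ ↦ L_{c_k}(ξ,λ_k) + (1/(2c_k))‖ξ − x_k‖² and λ̄_k = λ_k + c_k(Ex̄_k − prox_{φ/c_k}(Ex̄_k + λ_k/c_k)). Then for any x_{k+1} ∈ ℝⁿ, with λ_{k+1} := λ_k + c_k(Ex_{k+1} − prox_{φ/c_k}(Ex_{k+1} + λ_k/c_k)), one has the estimate ‖(x_{k+1},λ_{k+1}) − (x̄_k,λ̄_k)‖ ≤ c_k ‖∇_x L_{c_k}(x_{k+1},λ_k) + c_k⁻¹(x_{k+1} − x_k)‖. -/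
noncomputable section

open Filter Set Topology
open scoped RealInnerProductSpace

/-- Euclidean space `ℝⁿ`. -/
abbrev En (n : ℕ) : Type := EuclideanSpace ℝ (Fin n)

/-- `φ` is a proper, lower semicontinuous (closed), convex extended-real-valued
function. -/
def ProperLscConvex {V : Type*} [NormedAddCommGroup V] [NormedSpace ℝ V]
    (φ : V → EReal) : Prop :=
  (∀ z, φ z ≠ ⊥) ∧ (∃ z, φ z ≠ ⊤) ∧ LowerSemicontinuous φ ∧
    ∀ z w : V, ∀ a b : ℝ, 0 ≤ a → 0 ≤ b → a + b = 1 →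
      φ (a • z + b • w) ≤ (a : EReal) * φ z + (b : EReal) * φ w

/-- The convex (Fenchel) conjugate `φ*`. -/
def econj {m : ℕ} (φ : En m → EReal) : En m → EReal :=
  fun y => ⨆ z : En m, (⟪y, z⟫ : EReal) - φ z

/-- The effective domain of an extended-real-valued function. -/
def edom {V : Type*} (g : V → EReal) : Set V := {z | g z ≠ ⊤}

/-- `p` is the proximal operator `prox_{φ/c}`: for every `z`, `p z` is the unique
minimizer of `u ↦ φ(u) + (c/2)‖u - z‖²`. -/
def IsProx {m : ℕ} (φ : En m → EReal) (c : ℝ) (p : En m → En m) : Prop :=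
  ∀ z : En m,
    (∀ u : En m,
      φ (p z) + ((c / 2 * ‖p z - z‖ ^ 2 : ℝ) : EReal)
        ≤ φ u + ((c / 2 * ‖u - z‖ ^ 2 : ℝ) : EReal)) ∧
    ∀ u : En m,
      (∀ v : En m,
        φ u + ((c / 2 * ‖u - z‖ ^ 2 : ℝ) : EReal)
          ≤ φ v + ((c / 2 * ‖v - z‖ ^ 2 : ℝ) : EReal)) → u = p z

/-- The Moreau envelope `φ_c` (expressed through the proximal operator `p`). -/
def menv {m : ℕ} (φ : En m → EReal) (c : ℝ) (p : En m → En m) (z : En m) : ℝ :=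
  (φ (p z)).toReal + c / 2 * ‖p z - z‖ ^ 2

/-- The Moreau envelope as an extended-real-valued infimum. -/
def menvE {m : ℕ} (φ : En m → EReal) (c : ℝ) (z : En m) : EReal :=
  ⨅ u : En m, φ u + ((c / 2 * ‖u - z‖ ^ 2 : ℝ) : EReal)

/-- The augmented Lagrangian `L_c(x,λ) = f(x) + φ_c(Ex + λ/c) - ‖λ‖²/(2c)`. -/
def AL {n m : ℕ} (f : En n → ℝ) (φ : En m → EReal) (c : ℝ) (p : En m → En m)
    (E : En n →L[ℝ] En m) (x : En n) (lam : En m) : ℝ :=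
  f x + menv φ c p (E x + c⁻¹ • lam) - ‖lam‖ ^ 2 / (2 * c)

/-- The ordinary Lagrangian `L(x,λ) = f(x) - φ*(λ) + ⟨λ, Ex⟩`. -/
def Lag {n m : ℕ} (f : En n → ℝ) (φ : En m → EReal) (E : En n →L[ℝ] En m)
    (x : En n) (lam : En m) : EReal :=
  ((f x + ⟪lam, E x⟫ : ℝ) : EReal) - econj φ lam

/-- The primal objective of problem (P). -/
def Pv {n m : ℕ} (f : En n → ℝ) (φ : En m → EReal) (E : En n →L[ℝ] En m)
    (x : En n) : EReal :=
  ((f x : ℝ) : EReal) + φ (E x)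

/-- The dual objective of problem (D): `-f*(-Eᵀλ) - φ*(λ)`. -/
def Dv {n m : ℕ} (f : En n → ℝ) (φ : En m → EReal) (E : En n →L[ℝ] En m)
    (lam : En m) : EReal :=
  - (econj (fun x : En n => ((f x : ℝ) : EReal)) (-(ContinuousLinearMap.adjoint E lam))
      + econj φ lam)

/-- Saddle point of an extended-real-valued Lagrangian. -/
def IsSaddle {n m : ℕ} (L : En n → En m → EReal) (xb : En n) (lb : En m) : Prop :=
  ∀ (x : En n) (lam : En m), L xb lam ≤ L xb lb ∧ L xb lb ≤ L x lb

/-- `g` is a subgradient of the extended-real-valued convex function `h` at `z`. -/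
def ESubgradAt {m : ℕ} (h : En m → EReal) (g : En m) (z : En m) : Prop :=
  ∀ y : En m, h z + ((⟪g, y - z⟫ : ℝ) : EReal) ≤ h y

/-- Closed form of the `x`-gradient of the augmented Lagrangian:
`∇f(x) + cEᵀ(Ex + λ/c - prox_{φ/c}(Ex + λ/c))`. -/
def gradALx {n m : ℕ} (f : En n → ℝ) (c : ℝ) (p : En m → En m)
    (E : En n →L[ℝ] En m) (lam : En m) (x : En n) : En n :=
  gradient f x +
    c • (ContinuousLinearMap.adjoint E) (E x + c⁻¹ • lam - p (E x + c⁻¹ • lam))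

/-- The regularized objective `ψ(ξ) = L_c(ξ,λ) + (1/(2c))‖ξ - x‖²`. -/
def psiFun {n m : ℕ} (f : En n → ℝ) (φ : En m → EReal) (c : ℝ) (p : En m → En m)
    (E : En n →L[ℝ] En m) (x : En n) (lam : En m) (ξ : En n) : ℝ :=
  AL f φ c p E ξ lam + 1 / (2 * c) * ‖ξ - x‖ ^ 2

/-- Closed form of `∇ψ`. -/
def gradPsi {n m : ℕ} (f : En n → ℝ) (c : ℝ) (p : En m → En m)
    (E : En n →L[ℝ] En m) (x : En n) (lam : En m) (ξ : En n) : En n :=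
  gradALx f c p E lam ξ + c⁻¹ • (ξ - x)

/-- Limiting (B-) Jacobian: limits of Jacobians along sequences of points of
differentiability. -/
def limJac {a b : ℕ} (Φ : En a → En b) (x : En a) : Set (En a →L[ℝ] En b) :=
  {G | ∃ u : ℕ → En a, (∀ k, DifferentiableAt ℝ Φ (u k)) ∧
        Tendsto u atTop (𝓝 x) ∧ Tendsto (fun k => fderiv ℝ Φ (u k)) atTop (𝓝 G)}

/-- Clarke generalized Jacobian. -/
def clarkeJac {a b : ℕ} (Φ : En a → En b) (x : En a) : Set (En a →L[ℝ] En b) :=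
  convexHull ℝ (limJac Φ x)

/-- Symmetry (self-adjointness) of a continuous linear operator. -/
def SymCLM {k : ℕ} (A : En k →L[ℝ] En k) : Prop :=
  ∀ u v : En k, ⟪A u, v⟫ = ⟪u, A v⟫

/-- Loewner order `A ⪯ B`. -/
def Loew {k : ℕ} (A B : En k →L[ℝ] En k) : Prop :=
  ∀ d : En k, ⟪d, A d⟫ ≤ ⟪d, B d⟫

/-- The set `T(ξ)` of generalized Hessians
`∇²f(ξ) + c⁻¹I + cEᵀ(I - G)E`, `G ∈ ∂prox_{φ/c}(Eξ + λ/c)`. -/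
def Tset {n m : ℕ} (f : En n → ℝ) (c : ℝ) (p : En m → En m) (E : En n →L[ℝ] En m)
    (lam : En m) (ξ : En n) : Set (En n →L[ℝ] En n) :=
  {V | ∃ G ∈ clarkeJac p (E ξ + c⁻¹ • lam),
      V = fderiv ℝ (gradient f) ξ + c⁻¹ • ContinuousLinearMap.id ℝ (En n) +
          c • ((ContinuousLinearMap.adjoint E).comp
                ((ContinuousLinearMap.id ℝ (En m) - G).comp E))}

/-- One-sided directional differentiability. -/
def DirDiffAt {a b : ℕ} (Φ : En a → En b) (y d : En a) : Prop :=
  ∃ D : En b, Tendsto (fun t : ℝ => t⁻¹ • (Φ (y + t • d) - Φ y)) (𝓝[>] (0 : ℝ)) (𝓝 D)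

/-- Semismoothness at a point. -/
def SemismoothAt {a b : ℕ} (Φ : En a → En b) (xb : En a) : Prop :=
  LocallyLipschitz Φ ∧ (∀ᶠ y in 𝓝 xb, ∀ d, DirDiffAt Φ y d) ∧
    ∀ ε > 0, ∃ δ > 0, ∀ x : En a, x ≠ xb → ‖x - xb‖ < δ →
      ∀ G ∈ clarkeJac Φ x, ‖Φ x + G (xb - x) - Φ xb‖ ≤ ε * ‖x - xb‖

/-- Strong semismoothness at a point. -/
def StronglySemismoothAt {a b : ℕ} (Φ : En a → En b) (xb : En a) : Prop :=
  LocallyLipschitz Φ ∧ (∀ᶠ y in 𝓝 xb, ∀ d, DirDiffAt Φ y d) ∧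
    ∃ C : ℝ, ∃ δ > 0, ∀ x : En a, ‖x - xb‖ < δ →
      ∀ G ∈ clarkeJac Φ x, ‖Φ x + G (xb - x) - Φ xb‖ ≤ C * ‖x - xb‖ ^ 2

/-- Linear Newton approximation (LNA) scheme of `Φ` at `xb`. -/
def IsLNAAt {a : ℕ} (S : En a → Set (En a →L[ℝ] En a)) (Φ : En a → En a)
    (xb : En a) : Prop :=
  (∀ η, (S η).Nonempty ∧ IsCompact (S η)) ∧
  (∀ U : Set (En a →L[ℝ] En a), IsOpen U → S xb ⊆ U → ∀ᶠ η in 𝓝 xb, S η ⊆ U) ∧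
  ∀ ε > 0, ∃ δ > 0, ∀ η : En a, η ≠ xb → ‖η - xb‖ < δ →
    ∀ H ∈ S η, ‖Φ η + H (xb - η) - Φ xb‖ ≤ ε * ‖η - xb‖

/-- Strong linear Newton approximation scheme of `Φ` at `xb`. -/
def IsStrongLNAAt {a : ℕ} (S : En a → Set (En a →L[ℝ] En a)) (Φ : En a → En a)
    (xb : En a) : Prop :=
  (∀ η, (S η).Nonempty ∧ IsCompact (S η)) ∧
  (∀ U : Set (En a →L[ℝ] En a), IsOpen U → S xb ⊆ U → ∀ᶠ η in 𝓝 xb, S η ⊆ U) ∧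
  ∃ C : ℝ, ∃ δ > 0, ∀ η : En a, ‖η - xb‖ < δ →
    ∀ H ∈ S η, ‖Φ η + H (xb - η) - Φ xb‖ ≤ C * ‖η - xb‖ ^ 2

/-- The Armijo condition with parameters `γ, ρ` at trial exponent `i`. -/
def ArmijoCond {n m : ℕ} (f : En n → ℝ) (φ : En m → EReal) (c : ℝ) (p : En m → En m)
    (E : En n →L[ℝ] En m) (x : En n) (lam : En m) (γ ρ : ℝ)
    (ξl dl : En n) (i : ℕ) : Prop :=
  psiFun f φ c p E x lam (ξl + ρ ^ i • dl)
    ≤ psiFun f φ c p E x lam ξl + γ * ρ ^ i * ⟪gradPsi f c p E x lam ξl, dl⟫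

lemma aux_grad {n : ℕ} (f : En n → ℝ) (hf : ContDiff ℝ 2 f) (x d : En n) :
    HasDerivAt (fun t : ℝ => f (x + t • d)) ⟪gradient f x, d⟫ 0 := by
  have h1 : HasFDerivAt f ((InnerProductSpace.toDual ℝ (En n)) (gradient f x)) x :=
    ((hf.differentiable (by norm_num)) x).hasGradientAt
  have h2 : HasDerivAt (fun t : ℝ => x + t • d) d 0 := by
    simpa using ((hasDerivAt_id (0:ℝ)).smul_const d).const_add x
  have h3 : HasFDerivAt f ((InnerProductSpace.toDual ℝ (En n)) (gradient f x))
      (x + (0:ℝ) • d) := by simpa using h1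
  have := h3.comp_hasDerivAt (0:ℝ) h2
  simpa [Function.comp_def] using this

lemma aux_convex {n : ℕ} (f : En n → ℝ) (hf : ContDiff ℝ 2 f)
    (hfconv : ConvexOn ℝ Set.univ f) (x y : En n) :
    f x + ⟪gradient f x, y - x⟫ ≤ f y := by
  have hg : ConvexOn ℝ Set.univ (fun t : ℝ => f (x + t • (y - x))) := by
    refine ⟨convex_univ, fun s _ t _ a b ha hb hab => ?_⟩
    have := hfconv.2 (mem_univ (x + s • (y - x))) (mem_univ (x + t • (y - x))) ha hb hab
    have e : a • (x + s • (y - x)) + b • (x + t • (y - x))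
        = x + (a • s + b • t) • (y - x) := by
      have : b = 1 - a := by linarith
      subst this
      simp only [smul_eq_mul]
      module
    rw [e] at this
    exact this
  have := hg.le_slope_of_hasDerivAt (mem_univ (0:ℝ)) (mem_univ (1:ℝ)) one_pos
    (aux_grad f hf x (y - x))
  simp only [slope_def_field, one_smul, zero_smul, add_zero, sub_zero, div_one,
    add_sub_cancel] at this
  linarith

lemma aux_fin {m : ℕ} (φ : En m → EReal) (hφ : ProperLscConvex φ) (c : ℝ)
    (p : En m → En m) (hp : IsProx φ c p) (z : En m) :
    φ (p z) = (((φ (p z)).toReal : ℝ) : EReal) := by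
  obtain ⟨hb, ⟨u, hu⟩, -, -⟩ := hφ
  refine (EReal.coe_toReal ?_ (hb _)).symm
  intro htop
  have := (hp z).1 u
  rw [htop, EReal.top_add_coe, ← EReal.coe_toReal hu (hb u), ← EReal.coe_add, top_le_iff] at this
  exact EReal.coe_ne_top _ this

lemma aux_sub {m : ℕ} (φ : En m → EReal) (hφ : ProperLscConvex φ) (c : ℝ) (hc : 0 < c)
    (p : En m → En m) (hp : IsProx φ c p) (z w : En m) :
    (φ (p z)).toReal + c * ⟪z - p z, p w - p z⟫ ≤ (φ (p w)).toReal := by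
  have ha := aux_fin φ hφ c p hp z
  have hb := aux_fin φ hφ c p hp w
  set a := (φ (p z)).toReal
  set b := (φ (p w)).toReal
  have key : ∀ t : ℝ, 0 < t → t < 1 →
      a + c * ⟪z - p z, p w - p z⟫ ≤ b + c / 2 * t * ‖p w - p z‖ ^ 2 := by
    intro t h0 h1
    have h := (hp z).1 ((1 - t) • p z + t • p w)
    have h2 := hφ.2.2.2 (p z) (p w) (1 - t) t (by linarith) h0.le (by ring)
    have h3 := h.trans (add_le_add_left h2 _)
    rw [ha, hb] at h3
    norm_cast at h3
    have e : (1 - t) • p z + t • p w - z = t • (p w - p z) - (z - p z) := by module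
    rw [e, norm_sub_sq_real (t • (p w - p z)) (z - p z), inner_smul_left, norm_smul, norm_sub_rev (p z) z,
      real_inner_comm] at h3
    simp only [conj_trivial, Real.norm_eq_abs, mul_pow, sq_abs] at h3
    have h4 : t * (a + c * ⟪z - p z, p w - p z⟫)
        ≤ t * (b + c / 2 * t * ‖p w - p z‖ ^ 2) := by nlinarith
    exact le_of_mul_le_mul_left h4 h0
  have lim : Tendsto (fun t : ℝ => b + c / 2 * t * ‖p w - p z‖ ^ 2) (𝓝[>] 0) (𝓝 b) := by
    have : Continuous (fun t : ℝ => b + c / 2 * t * ‖p w - p z‖ ^ 2) := by fun_prop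
    have := this.tendsto 0
    simp only [mul_zero, zero_mul, add_zero] at this
    exact this.mono_left nhdsWithin_le_nhds
  refine ge_of_tendsto lim ?_
  filter_upwards [Ioo_mem_nhdsGT (zero_lt_one (α := ℝ))] with t ht using key t ht.1 ht.2

lemma aux_env {m : ℕ} (φ : En m → EReal) (hφ : ProperLscConvex φ) (c : ℝ)
    (p : En m → En m) (hp : IsProx φ c p) (z w : En m) :
    menv φ c p w ≤ (φ (p z)).toReal + c / 2 * ‖p z - w‖ ^ 2 := by
  have h := (hp w).1 (p z)
  rw [aux_fin φ hφ c p hp z, aux_fin φ hφ c p hp w] at h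
  exact_mod_cast h

lemma aux_sq {k : ℕ} (u v : En k) :
    HasDerivAt (fun t : ℝ => ‖u + t • v‖ ^ 2) (2 * ⟪u, v⟫) 0 := by
  have h2 : HasDerivAt (fun t : ℝ => u + t • v) v 0 := by
    simpa using ((hasDerivAt_id (0:ℝ)).smul_const v).const_add u
  simpa using h2.norm_sq

lemma aux_opt {n m : ℕ} (f : En n → ℝ)
    (hf : ContDiff ℝ 2 f)
    (φ : En m → EReal) (hφ : ProperLscConvex φ) (E : En n →L[ℝ] En m)
    (c : ℝ) (hc : 0 < c) (p : En m → En m) (hp : IsProx φ c p)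
    (xk : En n) (lamk : En m) (xb : En n)
    (hxb : ∀ ξ : En n, ξ ≠ xb →
      psiFun f φ c p E xk lamk xb < psiFun f φ c p E xk lamk ξ) (d : En n) :
    ⟪gradient f xb, d⟫ + c * ⟪E xb + c⁻¹ • lamk - p (E xb + c⁻¹ • lamk), E d⟫
      + c⁻¹ * ⟪xb - xk, d⟫ = 0 := by
  set z := E xb + c⁻¹ • lamk with hz
  have hd := ((aux_grad f hf xb d).add ((aux_sq (z - p z) (E d)).const_mul (c / 2))).add
    ((aux_sq (xb - xk) d).const_mul (1 / (2 * c)))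
  have hm : IsLocalMin (((fun t : ℝ => f (xb + t • d)) +
      (fun t : ℝ => c / 2 * ‖z - p z + t • E d‖ ^ 2)) +
      (fun t : ℝ => 1 / (2 * c) * ‖xb - xk + t • d‖ ^ 2)) 0 := by
    refine Filter.Eventually.of_forall fun t => ?_
    have h1 : psiFun f φ c p E xk lamk xb ≤ psiFun f φ c p E xk lamk (xb + t • d) := by
      by_cases h : xb + t • d = xb
      · rw [h]
      · exact (hxb _ h).le
    have h2 := aux_env φ hφ c p hp z (E (xb + t • d) + c⁻¹ • lamk)
    have e1 : p z - (E (xb + t • d) + c⁻¹ • lamk) = -(z - p z + t • E d) := by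
      rw [hz, map_add, map_smul]; module
    have e2 : xb + t • d - xk = xb - xk + t • d := by module
    rw [e1, norm_neg] at h2
    simp only [psiFun, AL, e2, ← hz] at h1
    have e3 : menv φ c p z = (φ (p z)).toReal + c / 2 * ‖z - p z‖ ^ 2 := by
      rw [menv, norm_sub_rev]
    simp only [Pi.add_apply, zero_smul, add_zero]
    linarith
  have h0 := hm.hasDerivAt_eq_zero hd
  rw [← h0]
  field_simp

/-- Prop. 3.3 of the paper, estimate (14). Distance of the
update `(x_{k+1},λ_{k+1})` to the exact proximal point is bounded by
`c_k ‖∇_x L_{c_k}(x_{k+1},λ_k) + c_k⁻¹(x_{k+1} - x_k)‖`. -/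
theorem proximal_point_estimate {n m : ℕ} (f : En n → ℝ)
    (hf : ContDiff ℝ 2 f) (hfconv : ConvexOn ℝ Set.univ f)
    (φ : En m → EReal) (hφ : ProperLscConvex φ) (E : En n →L[ℝ] En m)
    (c : ℝ) (hc : 0 < c) (p : En m → En m) (hp : IsProx φ c p)
    (xk : En n) (lamk : En m) (xb : En n)
    (hxb : ∀ ξ : En n, ξ ≠ xb →
      psiFun f φ c p E xk lamk xb < psiFun f φ c p E xk lamk ξ)
    (lb : En m) (hlb : lb = lamk + c • (E xb - p (E xb + c⁻¹ • lamk)))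
    (x1 : En n) (lam1 : En m)
    (hlam1 : lam1 = lamk + c • (E x1 - p (E x1 + c⁻¹ • lamk))) :
    Real.sqrt (‖x1 - xb‖ ^ 2 + ‖lam1 - lb‖ ^ 2)
      ≤ c * ‖gradALx f c p E lamk x1 + c⁻¹ • (x1 - xk)‖ := by
  set z1 := E x1 + c⁻¹ • lamk with hz1
  set zb := E xb + c⁻¹ • lamk with hzb
  have hl1 : lam1 = c • (z1 - p z1) := by
    rw [hlam1, hz1, smul_sub, smul_sub, smul_add, smul_inv_smul₀ hc.ne']; module
  have hl2 : lb = c • (zb - p zb) := by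
    rw [hlb, hzb, smul_sub, smul_sub, smul_add, smul_inv_smul₀ hc.ne']; module
  have hopt := aux_opt f hf φ hφ E c hc p hp xk lamk xb hxb (x1 - xb)
  rw [← hzb] at hopt
  have c1 := aux_convex f hf hfconv x1 xb
  have c2 := aux_convex f hf hfconv xb x1
  have s1 := aux_sub φ hφ c hc p hp z1 zb
  have s2 := aux_sub φ hφ c hc p hp zb z1
  have hE : E (x1 - xb) = z1 - zb := by rw [hz1, hzb, map_sub]; module
  set G := gradALx f c p E lamk x1 + c⁻¹ • (x1 - xk) with hG
  have hGi : ⟪G, x1 - xb⟫ = ⟪gradient f x1, x1 - xb⟫ + c * ⟪z1 - p z1, z1 - zb⟫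
      + c⁻¹ * ⟪x1 - xk, x1 - xb⟫ := by
    rw [hG, gradALx, ← hz1, inner_add_left, inner_add_left, real_inner_smul_left,
      real_inner_smul_left, ContinuousLinearMap.adjoint_inner_left, hE]
  rw [hE] at hopt
  have n1 : ⟪gradient f x1, xb - x1⟫ = - ⟪gradient f x1, x1 - xb⟫ := by
    rw [← inner_neg_right, neg_sub]
  have n2 : ⟪x1 - xk, x1 - xb⟫ - ⟪xb - xk, x1 - xb⟫ = ‖x1 - xb‖ ^ 2 := by
    rw [← inner_sub_left, ← real_inner_self_eq_norm_sq]; congr 1; module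
  have n3 : ⟪z1 - p z1, p zb - p z1⟫ = - ⟪z1 - p z1, p z1 - p zb⟫ := by
    rw [← inner_neg_right, neg_sub]
  have n4 : ‖lam1 - lb‖ ^ 2 = c ^ 2 * (⟪z1 - p z1, z1 - zb⟫ - ⟪z1 - p z1, p z1 - p zb⟫
      - (⟪zb - p zb, z1 - zb⟫ - ⟪zb - p zb, p z1 - p zb⟫)) := by
    rw [hl1, hl2, ← smul_sub, norm_smul, mul_pow, Real.norm_eq_abs, sq_abs,
      ← inner_sub_right, ← inner_sub_right, ← inner_sub_left, ← real_inner_self_eq_norm_sq]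
    congr 2
    module
  have cs := real_inner_le_norm G (x1 - xb)
  set S := ‖x1 - xb‖ ^ 2 + ‖lam1 - lb‖ ^ 2 with hS
  have hS0 : 0 ≤ S := by positivity
  have main : S ≤ c * (‖G‖ * ‖x1 - xb‖) := by
    have hi : c * c⁻¹ = 1 := mul_inv_cancel₀ hc.ne'
    have a1 : c⁻¹ * ‖x1 - xb‖ ^ 2 + c * (⟪z1 - p z1, z1 - zb⟫ - ⟪z1 - p z1, p z1 - p zb⟫
      - (⟪zb - p zb, z1 - zb⟫ - ⟪zb - p zb, p z1 - p zb⟫)) ≤ ⟪G, x1 - xb⟫ := by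
      rw [hGi, ← n2]
      rw [n3] at s1
      rw [n1] at c1
      linarith
    have a2 := mul_le_mul_of_nonneg_left (a1.trans cs) hc.le
    rw [mul_add, ← mul_assoc, hi, one_mul, ← mul_assoc, ← sq, ← n4] at a2
    exact a2
  have hx : ‖x1 - xb‖ ≤ Real.sqrt S := by
    apply Real.le_sqrt_of_sq_le
    rw [hS]; nlinarith [sq_nonneg ‖lam1 - lb‖]
  rcases (Real.sqrt_nonneg S).eq_or_lt with h | h
  · rw [← h]; positivity
  · have : Real.sqrt S * Real.sqrt S ≤ (c * ‖G‖) * Real.sqrt S := by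
      rw [Real.mul_self_sqrt hS0]
      calc S ≤ c * (‖G‖ * ‖x1 - xb‖) := main
        _ = (c * ‖G‖) * ‖x1 - xb‖ := by ring
        _ ≤ _ := by gcongr
    exact le_of_mul_le_mul_right this h
end
end

section
/- In the setting of the previous estimate, suppose in addition that x_{k+1} satisfies the accuracy criterion ‖∇_x L_{c_k}(x_{k+1},λ_k) + c_k⁻¹(x_{k+1} − x_k)‖ ≤ (ε_k/c_k)·min(1, ‖(x_{k+1},λ_{k+1}) − (x_k,λ_k)‖^r) for some ε_k > 0 and r ≥ 0. Then ‖(x_{k+1},λ_{k+1}) − (x̄_k,λ̄_k)‖ ≤ ε_k·min(1, ‖(x_{k+1},λ_{k+1}) − (x_k,λ_k)‖^r), where (x̄_k,λ̄_k) is the exact proximal point (x̄_k the unique minimizer of ξ ↦ L_{c_k}(ξ,λ_k) + (1/(2c_k))‖ξ − x_k‖², λ̄_k its multiplier update) and λ_{k+1} := λ_k + c_k(Ex_{k+1} − prox_{φ/c_k}(Ex_{k+1} + λ_k/c_k)). -/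
noncomputable section

open Filter Set Topology
open scoped RealInnerProductSpace

lemma aux_limit {A B : ℝ} (h : ∀ t : ℝ, 0 < t → t ≤ 1 → 0 ≤ A + t * B) : 0 ≤ A := by
  by_contra hA
  push Not at hA
  have hB : 0 < B := by
    have := h 1 one_pos le_rfl
    linarith
  have h1 : 0 < -A / (2 * B) := by apply div_pos <;> linarith
  rcases le_total (-A / (2 * B)) 1 with h2 | h2
  · have := h _ h1 h2
    have e : -A / (2 * B) * B = -A / 2 := by field_simp
    rw [e] at this
    linarith
  · rw [le_div_iff₀ (by linarith)] at h2
    have := h 1 one_pos le_rfl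
    linarith

lemma prox_ne_top {m : ℕ} {φ : En m → EReal} (hφ : ProperLscConvex φ)
    {c : ℝ} {p : En m → En m} (hp : IsProx φ c p) (z : En m) : φ (p z) ≠ ⊤ := by
  obtain ⟨u, hu⟩ := hφ.2.1
  intro h
  have h1 := (hp z).1 u
  rw [h, EReal.top_add_coe, top_le_iff] at h1
  lift φ u to ℝ using ⟨hu, hφ.1 u⟩ with a
  rw [← EReal.coe_add] at h1
  exact EReal.coe_ne_top _ h1

lemma prox_coe {m : ℕ} {φ : En m → EReal} (hφ : ProperLscConvex φ)
    {c : ℝ} {p : En m → En m} (hp : IsProx φ c p) (z : En m) :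
    φ (p z) = (((φ (p z)).toReal : ℝ) : EReal) :=
  (EReal.coe_toReal (prox_ne_top hφ hp z) (hφ.1 _)).symm

lemma menv_le {m : ℕ} {φ : En m → EReal} (hφ : ProperLscConvex φ)
    {c : ℝ} {p : En m → En m} (hp : IsProx φ c p) (z w : En m) :
    menv φ c p z ≤ (φ (p w)).toReal + c / 2 * ‖p w - z‖ ^ 2 := by
  have h := (hp z).1 (p w)
  rw [prox_coe hφ hp z, prox_coe hφ hp w] at h
  exact_mod_cast h

lemma prox_var {m : ℕ} {φ : En m → EReal} (hφ : ProperLscConvex φ)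
    {c : ℝ} {p : En m → En m} (hp : IsProx φ c p) (z w : En m) :
    (φ (p z)).toReal ≤ (φ (p w)).toReal + c * ⟪p z - z, p w - p z⟫ := by
  have key : 0 ≤ (φ (p w)).toReal + c * ⟪p z - z, p w - p z⟫ - (φ (p z)).toReal := by
    apply aux_limit (B := c / 2 * ‖p w - p z‖ ^ 2)
    intro t ht ht1
    have h1 := (hp z).1 ((1 - t) • p z + t • p w)
    have h2 := hφ.2.2.2 (p z) (p w) (1 - t) t (by linarith) ht.le (by ring)
    have h3 := h1.trans (add_le_add_left h2 _)
    rw [prox_coe hφ hp z, prox_coe hφ hp w] at h3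
    have h4 : (φ (p z)).toReal + c / 2 * ‖p z - z‖ ^ 2 ≤
      (1 - t) * (φ (p z)).toReal + t * (φ (p w)).toReal +
        c / 2 * ‖(1 - t) • p z + t • p w - z‖ ^ 2 := by
      exact_mod_cast h3
    have e : (1 - t) • p z + t • p w - z = (p z - z) + t • (p w - p z) := by module
    rw [e, norm_add_sq_real, norm_smul, inner_smul_right, Real.norm_eq_abs, mul_pow, sq_abs] at h4
    have h5 : 0 ≤ t * ((φ (p w)).toReal + c * ⟪p z - z, p w - p z⟫ - (φ (p z)).toReal
      + t * (c / 2 * ‖p w - p z‖ ^ 2)) := by nlinarith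
    exact nonneg_of_mul_nonneg_right h5 ht
  linarith

lemma prox_mono {m : ℕ} {φ : En m → EReal} (hφ : ProperLscConvex φ)
    {c : ℝ} (hc : 0 < c) {p : En m → En m} (hp : IsProx φ c p) (z w : En m) :
    0 ≤ ⟪(z - p z) - (w - p w), p z - p w⟫ := by
  have h1 := prox_var hφ hp z w
  have h2 := prox_var hφ hp w z
  have e : ⟪(z - p z) - (w - p w), p z - p w⟫ = ⟪p z - z, p w - p z⟫ + ⟪p w - w, p z - p w⟫ := by
    simp only [inner_sub_left, inner_sub_right]; ring
  rw [e]
  refine nonneg_of_mul_nonneg_right (a := c) ?_ hc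
  linarith

lemma grad_ineq {n : ℕ} {f : En n → ℝ} (hf : Differentiable ℝ f)
    (hc : ConvexOn ℝ Set.univ f) (x y : En n) :
    f x + ⟪gradient f x, y - x⟫ ≤ f y := by
  have hd : HasDerivAt (fun t : ℝ => f (x + t • (y - x))) (⟪gradient f x, y - x⟫) 0 := by
    have h1 : HasFDerivAt f (InnerProductSpace.toDual ℝ _ (gradient f x)) (x + (0:ℝ) • (y - x)) := by
      rw [zero_smul, add_zero]
      exact (hf x).hasGradientAt.hasFDerivAt
    have h2 : HasDerivAt (fun t : ℝ => x + t • (y - x)) (y - x) 0 := by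
      simpa using ((hasDerivAt_id (0:ℝ)).smul_const (y - x)).const_add x
    exact h1.comp_hasDerivAt (0:ℝ) h2
  have hcv : ConvexOn ℝ Set.univ (fun t : ℝ => f (x + t • (y - x))) := by
    refine ⟨convex_univ, fun s _ t _ a b ha hb hab => ?_⟩
    have := hc.2 (mem_univ (x + s • (y - x))) (mem_univ (x + t • (y - x))) ha hb hab
    have e : x + (a • s + b • t) • (y - x) = a • (x + s • (y - x)) + b • (x + t • (y - x)) := by
      have hb' : b = 1 - a := by linarith
      subst hb'
      simp only [smul_eq_mul]
      module
    simpa only [e] using this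
  have := hcv.le_slope_of_hasDerivAt (mem_univ 0) (mem_univ 1) one_pos hd
  simp only [slope, sub_zero, inv_one, one_smul, zero_smul, add_zero, vsub_eq_sub,
    add_sub_cancel] at this
  linarith

lemma opt_cond {n m : ℕ} (f : En n → ℝ)
    (hf : Differentiable ℝ f)
    (φ : En m → EReal) (hφ : ProperLscConvex φ) (E : En n →L[ℝ] En m)
    (c : ℝ) (hc : 0 < c) (p : En m → En m) (hp : IsProx φ c p)
    (xk : En n) (lamk : En m) (xb : En n)
    (hxb : ∀ ξ : En n, ξ ≠ xb →
      psiFun f φ c p E xk lamk xb < psiFun f φ c p E xk lamk ξ) (d : En n) :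
    ⟪gradient f xb, d⟫ + c * ⟪E xb + c⁻¹ • lamk - p (E xb + c⁻¹ • lamk), E d⟫
      + c⁻¹ * ⟪xb - xk, d⟫ = 0 := by
  set z := E xb + c⁻¹ • lamk with hz
  let g : ℝ → ℝ := fun t => f (xb + t • d) + c / 2 * ‖(z - p z) + t • E d‖ ^ 2
    + 1 / (2 * c) * ‖(xb - xk) + t • d‖ ^ 2
  have hmin : IsLocalMin g 0 := by
    refine Filter.Eventually.of_forall fun t => ?_
    have h1 : psiFun f φ c p E xk lamk xb ≤ psiFun f φ c p E xk lamk (xb + t • d) := by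
      by_cases h : xb + t • d = xb
      · rw [h]
      · exact (hxb _ h).le
    have h2 := menv_le hφ hp (E (xb + t • d) + c⁻¹ • lamk) z
    simp only [psiFun, AL] at h1
    rw [← hz] at h1
    have e1 : p z - (E (xb + t • d) + c⁻¹ • lamk) = - ((z - p z) + t • E d) := by
      rw [hz, map_add, map_smul]; module
    have e2 : xb + t • d - xk = (xb - xk) + t • d := by module
    rw [e1, norm_neg] at h2
    rw [e2] at h1
    have e3 : menv φ c p z = (φ (p z)).toReal + c / 2 * ‖z - p z‖ ^ 2 := by
      rw [menv, norm_sub_rev]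
    simp only [g, zero_smul, add_zero]
    linarith
  have hline : ∀ {k : ℕ} (a b : En k), HasDerivAt (fun t : ℝ => a + t • b) b 0 := by
    intro k a b
    simpa using ((hasDerivAt_id (0:ℝ)).smul_const b).const_add a
  have hd : HasDerivAt (fun t : ℝ => f (xb + t • d)) (⟪gradient f xb, d⟫) 0 := by
    have h1 : HasFDerivAt f (InnerProductSpace.toDual ℝ _ (gradient f xb)) (xb + (0:ℝ) • d) := by
      rw [zero_smul, add_zero]
      exact (hf xb).hasGradientAt.hasFDerivAt
    exact h1.comp_hasDerivAt (0:ℝ) (hline xb d)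
  have hg := (hd.add ((hline (z - p z) (E d)).norm_sq.const_mul (c / 2))).add
    ((hline (xb - xk) d).norm_sq.const_mul (1 / (2 * c)))
  have := hmin.hasDerivAt_eq_zero hg
  simp only [zero_smul, add_zero] at this
  rw [← this]
  field_simp

/-- estimate (15). Under the accuracy criterion, the update
is within `ε_k · min(1, ‖(x_{k+1},λ_{k+1}) - (x_k,λ_k)‖^r)` of the exact
proximal point. -/
theorem proximal_point_estimate_accuracy {n m : ℕ} (f : En n → ℝ)
    (hf : ContDiff ℝ 2 f) (hfconv : ConvexOn ℝ Set.univ f)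
    (φ : En m → EReal) (hφ : ProperLscConvex φ) (E : En n →L[ℝ] En m)
    (c : ℝ) (hc : 0 < c) (p : En m → En m) (hp : IsProx φ c p)
    (xk : En n) (lamk : En m) (xb : En n)
    (hxb : ∀ ξ : En n, ξ ≠ xb →
      psiFun f φ c p E xk lamk xb < psiFun f φ c p E xk lamk ξ)
    (lb : En m) (hlb : lb = lamk + c • (E xb - p (E xb + c⁻¹ • lamk)))
    (x1 : En n) (lam1 : En m)
    (hlam1 : lam1 = lamk + c • (E x1 - p (E x1 + c⁻¹ • lamk)))
    (ε r : ℝ) (hε : 0 < ε) (hr : 0 ≤ r)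
    (hacc : ‖gradALx f c p E lamk x1 + c⁻¹ • (x1 - xk)‖
      ≤ ε / c * min 1 ((Real.sqrt (‖x1 - xk‖ ^ 2 + ‖lam1 - lamk‖ ^ 2)) ^ r)) :
    Real.sqrt (‖x1 - xb‖ ^ 2 + ‖lam1 - lb‖ ^ 2)
      ≤ ε * min 1 ((Real.sqrt (‖x1 - xk‖ ^ 2 + ‖lam1 - lamk‖ ^ 2)) ^ r) := by
  have hfd : Differentiable ℝ f := hf.differentiable (by norm_num)
  have hopt := opt_cond f hfd φ hφ E c hc p hp xk lamk xb hxb (x1 - xb)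
  have hmono := prox_mono hφ hc hp (E x1 + c⁻¹ • lamk) (E xb + c⁻¹ • lamk)
  have hg1 := grad_ineq hfd hfconv x1 xb
  have hg2 := grad_ineq hfd hfconv xb x1
  set M := min 1 ((Real.sqrt (‖x1 - xk‖ ^ 2 + ‖lam1 - lamk‖ ^ 2)) ^ r) with hM
  clear_value M
  set g := gradALx f c p E lamk x1 + c⁻¹ • (x1 - xk) with hg
  have hq1 : E x1 + c⁻¹ • lamk - p (E x1 + c⁻¹ • lamk) = c⁻¹ • lam1 := by
    rw [hlam1, smul_add, smul_smul, inv_mul_cancel₀ hc.ne']; module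
  have hqb : E xb + c⁻¹ • lamk - p (E xb + c⁻¹ • lamk) = c⁻¹ • lb := by
    rw [hlb, smul_add, smul_smul, inv_mul_cancel₀ hc.ne']; module
  have hp1 : p (E x1 + c⁻¹ • lamk) - p (E xb + c⁻¹ • lamk)
      = E (x1 - xb) - c⁻¹ • (lam1 - lb) := by
    rw [map_sub, smul_sub, ← hq1, ← hqb]; module
  rw [hq1, hqb, hp1, ← smul_sub, real_inner_smul_left, inner_sub_right, real_inner_smul_right,
    real_inner_self_eq_norm_sq] at hmono
  have hmono' := nonneg_of_mul_nonneg_right hmono (inv_pos.2 hc)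
  rw [hqb, real_inner_smul_left, mul_inv_cancel_left₀ hc.ne'] at hopt
  have hgi : ⟪g, x1 - xb⟫ = ⟪gradient f x1, x1 - xb⟫ + ⟪lam1, E (x1 - xb)⟫
      + c⁻¹ * ⟪x1 - xk, x1 - xb⟫ := by
    rw [hg, gradALx, hq1, inner_add_left, inner_add_left, real_inner_smul_left, map_smul,
      real_inner_smul_left, mul_inv_cancel_left₀ hc.ne' , ContinuousLinearMap.adjoint_inner_left,
      real_inner_smul_left]
  have e1 : ⟪x1 - xk, x1 - xb⟫ = ⟪xb - xk, x1 - xb⟫ + ‖x1 - xb‖ ^ 2 := by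
    rw [← real_inner_self_eq_norm_sq, ← inner_add_left]; congr 1; abel
  have e2 : ⟪gradient f x1, xb - x1⟫ = - ⟪gradient f x1, x1 - xb⟫ := by
    rw [← inner_neg_right, neg_sub]
  rw [e2] at hg1
  rw [inner_sub_left] at hmono'
  rw [e1] at hgi
  have hmain : c⁻¹ * (‖x1 - xb‖ ^ 2 + ‖lam1 - lb‖ ^ 2) ≤ ⟪g, x1 - xb⟫ := by
    rw [hgi]; linarith
  have hcs := real_inner_le_norm g (x1 - xb)
  set D := Real.sqrt (‖x1 - xb‖ ^ 2 + ‖lam1 - lb‖ ^ 2) with hD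
  have hD2 : D ^ 2 = ‖x1 - xb‖ ^ 2 + ‖lam1 - lb‖ ^ 2 := Real.sq_sqrt (by positivity)
  have hxD : ‖x1 - xb‖ ≤ D := Real.le_sqrt_of_sq_le (by nlinarith [sq_nonneg ‖lam1 - lb‖])
  have hD0 : 0 ≤ D := Real.sqrt_nonneg _
  have h1 : c⁻¹ * D ^ 2 ≤ ε / c * M * D := by
    rw [hD2]
    calc _ ≤ ‖g‖ * ‖x1 - xb‖ := hmain.trans hcs
      _ ≤ ‖g‖ * D := by gcongr
      _ ≤ _ := by gcongr
  have h2 : D * D ≤ ε * M * D := by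
    have := mul_le_mul_of_nonneg_left h1 hc.le
    field_simp at this
    nlinarith
  rcases hD0.eq_or_lt with h0 | h0
  · rw [← h0]
    have : 0 ≤ ε / c * M := (norm_nonneg _).trans hacc
    have e : ε * M = c * (ε / c * M) := by field_simp
    rw [e]; positivity
  · exact le_of_mul_le_mul_right h2 h0
end
end

section
/- Fix x ∈ ℝⁿ, λ ∈ ℝᵐ, c > 0, γ ∈ (0,1/2) and ρ ∈ (0,1), and let ξ* be the unique global minimizer of ψ. Let {ξ_ℓ} be generated from any initial point ξ₀ by: choose any symmetric matrix V_ℓ with c⁻¹I ⪯ V_ℓ ⪯ ∇²f(ξ_ℓ) + (c⁻¹ + c‖E‖²)I (in particular any V_ℓ ∈ T(ξ_ℓ)), solve V_ℓ d_ℓ = −∇ψ(ξ_ℓ), let τ_ℓ = ρ^i with i the smallest nonnegative integer satisfying the Armijo condition ψ(ξ_ℓ + ρ^i d_ℓ) ≤ ψ(ξ_ℓ) + γρ^i ⟨∇ψ(ξ_ℓ), d_ℓ⟩, and set ξ_{ℓ+1} = ξ_ℓ + τ_ℓ d_ℓ. Then the Armijo step is well defined at every nonstationary iterate, the sequence {ξ_ℓ}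 is bounded, and {ξ_ℓ} converges to ξ*. -/
noncomputable section

open Filter Set Topology
open scoped RealInnerProductSpace

lemma aux_lim (A B : ℝ) (h : ∀ t : ℝ, 0 < t → t ≤ 1 → 0 ≤ A + t * B) : 0 ≤ A := by
  by_contra hA
  push Not at hA
  have hB : 0 < |B| + 1 := by positivity
  have ht : 0 < min 1 (-A / (2 * (|B| + 1))) := by
    apply lt_min one_pos; apply div_pos <;> linarith
  have h1 := h _ ht (min_le_left _ _)
  have h2 : min 1 (-A / (2 * (|B| + 1))) * B ≤ (-A / (2 * (|B| + 1))) * (|B| + 1) := by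
    have : B ≤ |B| + 1 := by linarith [le_abs_self B]
    exact (mul_le_mul_of_nonneg_left this ht.le).trans
      (mul_le_mul_of_nonneg_right (min_le_right _ _) hB.le)
  have h3 : (-A / (2 * (|B| + 1))) * (|B| + 1) = -A / 2 := by field_simp
  linarith

lemma prox_finite {m : ℕ} {φ : En m → EReal} (hφ : ProperLscConvex φ) {c : ℝ}
    {p : En m → En m} (hp : IsProx φ c p) (z : En m) : ((φ (p z)).toReal : EReal) = φ (p z) := by
  obtain ⟨hb, ⟨u, hu⟩, -, -⟩ := hφ
  apply EReal.coe_toReal _ (hb _)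
  intro htop
  have h := (hp z).1 u
  rw [htop] at h
  rw [EReal.top_add_coe, top_le_iff] at h
  lift φ u to ℝ using ⟨hu, hb u⟩ with a
  exact absurd h (by norm_cast; exact EReal.coe_ne_top _)

lemma prox_vi {m : ℕ} {φ : En m → EReal} (hφ : ProperLscConvex φ) {c : ℝ}
    {p : En m → En m} (hp : IsProx φ c p) (z w : En m) :
    (φ (p z)).toReal + c * ⟪z - p z, p w - p z⟫ ≤ (φ (p w)).toReal := by
  have hz := prox_finite hφ hp z
  have hw := prox_finite hφ hp w
  set a := (φ (p z)).toReal
  set b := (φ (p w)).toReal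
  have key : 0 ≤ (b - a - c * ⟪z - p z, p w - p z⟫) := by
    apply aux_lim _ (c / 2 * ‖p w - p z‖ ^ 2)
    intro t ht ht1
    have h1 := (hp z).1 ((1 - t) • p z + t • p w)
    have h2 := hφ.2.2.2 (p z) (p w) (1 - t) t (by linarith) ht.le (by ring)
    have h3 := h1.trans (add_le_add_left h2 _)
    rw [← hz, ← hw] at h3
    norm_cast at h3
    have e : (1 - t) • p z + t • p w - z = t • (p w - p z) - (z - p z) := by module
    rw [e, norm_sub_sq_real (t • (p w - p z)), norm_smul, inner_smul_left, real_inner_comm, norm_sub_rev (p z) z, mul_pow,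
      Real.norm_eq_abs, sq_abs] at h3
    simp only [conj_trivial] at h3
    have : 0 ≤ t * ((b - a - c * ⟪z - p z, p w - p z⟫) + t * (c / 2 * ‖p w - p z‖ ^ 2)) := by
      nlinarith
    exact nonneg_of_mul_nonneg_right this ht
  linarith

lemma prox_upper {m : ℕ} {φ : En m → EReal} (hφ : ProperLscConvex φ) {c : ℝ}
    {p : En m → En m} (hp : IsProx φ c p) (z w : En m) :
    menv φ c p w ≤ menv φ c p z + c * ⟪z - p z, w - z⟫ + c / 2 * ‖w - z‖ ^ 2 := by
  have h := (hp w).1 (p z)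
  rw [← prox_finite hφ hp z, ← prox_finite hφ hp w] at h
  norm_cast at h
  have e : p z - w = -((z - p z) + (w - z)) := by abel
  rw [e, norm_neg, norm_add_sq_real] at h
  unfold menv
  rw [norm_sub_rev (p z) z]
  linarith

lemma prox_lower {m : ℕ} {φ : En m → EReal} (hφ : ProperLscConvex φ) {c : ℝ} (hc : 0 < c)
    {p : En m → En m} (hp : IsProx φ c p) (z w : En m) :
    menv φ c p z + c * ⟪z - p z, w - z⟫ ≤ menv φ c p w := by
  have h := prox_vi hφ hp z w
  unfold menv
  rw [norm_sub_rev (p z) z, norm_sub_rev (p w) w]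
  have e : p w - p z = (z - p z) - (w - p w) + (w - z) := by abel
  rw [e, inner_add_right, inner_sub_right, real_inner_self_eq_norm_sq] at h
  have h2 := norm_sub_sq_real (z - p z) (w - p w)
  have h3 : 0 ≤ c / 2 * ‖(z - p z) - (w - p w)‖ ^ 2 := by positivity
  rw [h2] at h3
  linarith

lemma prox_cont {m : ℕ} {φ : En m → EReal} (hφ : ProperLscConvex φ) {c : ℝ} (hc : 0 < c)
    {p : En m → En m} (hp : IsProx φ c p) : Continuous p := by
  have : LipschitzWith 1 p := by
    apply LipschitzWith.of_dist_le_mul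
    intro z w
    rw [dist_eq_norm, dist_eq_norm, NNReal.coe_one, one_mul]
    have h1 := prox_vi hφ hp z w
    have h2 := prox_vi hφ hp w z
    have h3 : c * (⟪z - p z, p w - p z⟫ + ⟪w - p w, p z - p w⟫) ≤ c * 0 := by linarith
    have h4 := le_of_mul_le_mul_left h3 hc
    have e : ⟪z - p z, p w - p z⟫ + ⟪w - p w, p z - p w⟫
        = ‖p z - p w‖ ^ 2 - ⟪z - w, p z - p w⟫ := by
      rw [← real_inner_self_eq_norm_sq]
      simp only [inner_sub_left, inner_sub_right]; ring
    rw [e] at h4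
    have h5 := real_inner_le_norm (z - w) (p z - p w)
    by_contra hlt
    push Not at hlt
    nlinarith [norm_nonneg (z - w), norm_nonneg (p z - p w)]
  exact this.continuous

lemma convex_first {n : ℕ} {f : En n → ℝ} (hf : Differentiable ℝ f)
    (hfc : ConvexOn ℝ Set.univ f) (z y : En n) : f z + ⟪gradient f z, y - z⟫ ≤ f y := by
  have hg := (hf z).hasGradientAt.hasFDerivAt
  have hl : HasDerivAt (fun t : ℝ => z + t • (y - z)) (y - z) 0 := by
    simpa using ((hasDerivAt_id (0:ℝ)).smul_const (y - z)).const_add z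
  have hz : z + (0:ℝ) • (y - z) = z := by simp
  have hd : HasDerivAt (fun t : ℝ => f (z + t • (y - z))) ⟪gradient f z, y - z⟫ 0 := by
    have := HasFDerivAt.comp_hasDerivAt (0:ℝ) (by rw [hz]; exact hg) hl
    exact this
  have ht := hd.tendsto_slope_zero_right
  have : ⟪gradient f z, y - z⟫ ≤ f y - f z := by
    apply le_of_tendsto ht
    filter_upwards [Ioo_mem_nhdsGT (show (0:ℝ) < 1 by norm_num)] with t ht
    have h1 := hfc.2 (mem_univ z) (mem_univ y) (by linarith [ht.2] : 0 ≤ 1 - t) ht.1.le (by ring)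
    have e : (1 - t) • z + t • y = z + (0 + t) • (y - z) := by module
    rw [e] at h1
    simp only [smul_eq_mul] at h1 ⊢
    rw [hz, inv_mul_le_iff₀ ht.1]
    linarith
  linarith

lemma symm_bound {n : ℕ} {V : En n →L[ℝ] En n} (hs : SymCLM V) (h0 : ∀ u, 0 ≤ ⟪u, V u⟫)
    {K : ℝ} (hK : 0 < K) (h1 : ∀ u, ⟪u, V u⟫ ≤ K * ‖u‖ ^ 2) (d : En n) :
    ‖V d‖ ^ 2 ≤ K * ⟪d, V d⟫ := by
  have h := h0 (K • d - V d)
  have h2 := h1 (V d)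
  have h3 : ⟪d, V (V d)⟫ = ‖V d‖ ^ 2 := by rw [← hs, real_inner_self_eq_norm_sq]
  simp only [map_sub, map_smul, inner_sub_left, inner_sub_right, inner_smul_left,
    inner_smul_right, conj_trivial, h3, real_inner_self_eq_norm_sq] at h
  have : 0 ≤ K * (K * ⟪d, V d⟫ - ‖V d‖ ^ 2) := by linarith
  linarith [nonneg_of_mul_nonneg_right this hK]

lemma grad_cont {n : ℕ} {f : En n → ℝ} (hf : ContDiff ℝ 2 f) : ContDiff ℝ 1 (gradient f) := by
  have h : ContDiff ℝ 1 (fderiv ℝ f) := hf.fderiv_right (by norm_num)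
  exact (InnerProductSpace.toDual ℝ (En n)).symm.contDiff.comp h

lemma psi_expand {n m : ℕ} (c : ℝ) (hc : 0 < c) (p : En m → En m) (f : En n → ℝ)
    (E : En n →L[ℝ] En m) (x : En n) (lam : En m) (z y : En n) :
    ⟪gradPsi f c p E x lam z, y - z⟫ = ⟪gradient f z, y - z⟫
      + c * ⟪(E z + c⁻¹ • lam) - p (E z + c⁻¹ • lam), (E y + c⁻¹ • lam) - (E z + c⁻¹ • lam)⟫
      + 1 / (2 * c) * (‖y - x‖ ^ 2 - ‖z - x‖ ^ 2 - ‖y - z‖ ^ 2) := by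
  have e : y - x = (y - z) + (z - x) := by abel
  have e2 : (E y + c⁻¹ • lam) - (E z + c⁻¹ • lam) = E (y - z) := by rw [map_sub]; abel
  rw [e2, e, norm_add_sq_real]
  unfold gradPsi gradALx
  rw [inner_add_left, inner_add_left, inner_smul_left, inner_smul_left,
    ContinuousLinearMap.adjoint_inner_left, real_inner_comm (z - x) (y - z)]
  simp only [conj_trivial]
  field_simp
  ring

lemma psi_lower {n m : ℕ} {f : En n → ℝ}
    (hf : Differentiable ℝ f) (hfconv : ConvexOn ℝ Set.univ f)
    {φ : En m → EReal} (hφ : ProperLscConvex φ) (E : En n →L[ℝ] En m)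
    {c : ℝ} (hc : 0 < c) {p : En m → En m} (hp : IsProx φ c p)
    (x : En n) (lam : En m) (z y : En n) :
    psiFun f φ c p E x lam z + ⟪gradPsi f c p E x lam z, y - z⟫ + 1 / (2 * c) * ‖y - z‖ ^ 2
      ≤ psiFun f φ c p E x lam y := by
  have h1 := convex_first hf hfconv z y
  have h2 := prox_lower hφ hc hp (E z + c⁻¹ • lam) (E y + c⁻¹ • lam)
  rw [psi_expand c hc]
  unfold psiFun AL
  linarith

lemma psi_upper {n m : ℕ} {f : En n → ℝ}
    {φ : En m → EReal} (hφ : ProperLscConvex φ) (E : En n →L[ℝ] En m)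
    {c : ℝ} (hc : 0 < c) {p : En m → En m} (hp : IsProx φ c p)
    (x : En n) (lam : En m) (z y : En n) (H : ℝ)
    (h1 : f y ≤ f z + ⟪gradient f z, y - z⟫ + H * ‖y - z‖ ^ 2) :
    psiFun f φ c p E x lam y ≤
    psiFun f φ c p E x lam z + ⟪gradPsi f c p E x lam z, y - z⟫
      + (H + c / 2 * ‖E‖ ^ 2 + 1 / (2 * c)) * ‖y - z‖ ^ 2 := by
  have h2 := prox_upper hφ hp (E z + c⁻¹ • lam) (E y + c⁻¹ • lam)
  have h3 : c / 2 * ‖(E y + c⁻¹ • lam) - (E z + c⁻¹ • lam)‖ ^ 2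
      ≤ c / 2 * ‖E‖ ^ 2 * ‖y - z‖ ^ 2 := by
    have e2 : (E y + c⁻¹ • lam) - (E z + c⁻¹ • lam) = E (y - z) := by rw [map_sub]; abel
    rw [e2, mul_assoc, ← mul_pow]
    have := E.le_opNorm (y - z)
    gcongr
  rw [psi_expand c hc]
  unfold psiFun AL
  linarith

lemma gradPsi_cont {n m : ℕ} {f : En n → ℝ} (hf : ContDiff ℝ 2 f)
    {φ : En m → EReal} (hφ : ProperLscConvex φ) (E : En n →L[ℝ] En m)
    {c : ℝ} (hc : 0 < c) {p : En m → En m} (hp : IsProx φ c p)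
    (x : En n) (lam : En m) : Continuous (gradPsi f c p E x lam) := by
  have h1 := (grad_cont hf).continuous
  have h2 := prox_cont hφ hc hp
  unfold gradPsi gradALx
  fun_prop

theorem newton_global_convergence {n m : ℕ} (f : En n → ℝ)
    (hf : ContDiff ℝ 2 f) (hfconv : ConvexOn ℝ Set.univ f)
    (φ : En m → EReal) (hφ : ProperLscConvex φ) (E : En n →L[ℝ] En m)
    (c : ℝ) (hc : 0 < c) (p : En m → En m) (hp : IsProx φ c p)
    (x : En n) (lam : En m)
    (γ ρ : ℝ) (hγ : γ ∈ Set.Ioo (0 : ℝ) (1 / 2)) (hρ : ρ ∈ Set.Ioo (0 : ℝ) 1)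
    (ξs : En n)
    (hmin : ∀ ξ : En n, ξ ≠ ξs →
      psiFun f φ c p E x lam ξs < psiFun f φ c p E x lam ξ)
    (ξ : ℕ → En n) (V : ℕ → En n →L[ℝ] En n) (d : ℕ → En n) (i : ℕ → ℕ)
    (hVsym : ∀ l, SymCLM (V l))
    (hVlow : ∀ l, Loew (c⁻¹ • ContinuousLinearMap.id ℝ (En n)) (V l))
    (hVup : ∀ l, Loew (V l) (fderiv ℝ (gradient f) (ξ l) +
        (c⁻¹ + c * ‖E‖ ^ 2) • ContinuousLinearMap.id ℝ (En n)))
    (hd : ∀ l, V l (d l) = -gradPsi f c p E x lam (ξ l))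
    (hi : ∀ l, ArmijoCond f φ c p E x lam γ ρ (ξ l) (d l) (i l) ∧
        ∀ j < i l, ¬ArmijoCond f φ c p E x lam γ ρ (ξ l) (d l) j)
    (hstep : ∀ l, ξ (l + 1) = ξ l + ρ ^ i l • d l) :
    (∀ l, gradPsi f c p E x lam (ξ l) ≠ 0 →
      ∃ j : ℕ, ArmijoCond f φ c p E x lam γ ρ (ξ l) (d l) j) ∧
    Bornology.IsBounded (Set.range ξ) ∧
    Tendsto ξ atTop (𝓝 ξs) := by
  refine ⟨fun l _ => ⟨i l, (hi l).1⟩, ?_⟩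
  have hfd : Differentiable ℝ f := hf.differentiable (by norm_num)
  have hgc := grad_cont hf
  have hgd : Differentiable ℝ (gradient f) := hgc.differentiable (by norm_num)
  have hHc : Continuous (fderiv ℝ (gradient f)) := hgc.continuous_fderiv (by norm_num)
  have hlow := psi_lower hfd hfconv hφ E hc hp x lam
  have hup := fun z y H => psi_upper (f := f) hφ E hc hp x lam z y H
  have hGc := gradPsi_cont hf hφ E hc hp x lam
  unfold ArmijoCond at hi
  set ψ := psiFun f φ c p E x lam with hψ
  set g := gradPsi f c p E x lam with hg
  have hmin' : ∀ y, ψ ξs ≤ ψ y := by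
    intro y
    by_cases h : y = ξs
    · rw [h]
    · exact (hmin y h).le
  have hci : 0 < c⁻¹ := inv_pos.mpr hc
  -- lower curvature
  have hVd : ∀ l u, c⁻¹ * ‖u‖ ^ 2 ≤ ⟪u, V l u⟫ := by
    intro l u
    have := hVlow l u
    simpa [inner_smul_right, real_inner_self_eq_norm_sq] using this
  have hgd' : ∀ l, ⟪g (ξ l), d l⟫ = - ⟪d l, V l (d l)⟫ := by
    intro l
    rw [hd l, inner_neg_right, neg_neg, real_inner_comm]
  have hgd0 : ∀ l, ⟪g (ξ l), d l⟫ ≤ - (c⁻¹ * ‖d l‖ ^ 2) := by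
    intro l
    have := hVd l (d l)
    rw [hgd' l]; linarith
  -- monotone
  have hmono : ∀ l, ψ (ξ (l + 1)) ≤ ψ (ξ l) + γ * ρ ^ i l * ⟪g (ξ l), d l⟫ := by
    intro l
    rw [hstep l]; exact (hi l).1
  have hρ0 : 0 < ρ := hρ.1
  have hγ0 : 0 < γ := hγ.1
  have hanti : Antitone (fun l => ψ (ξ l)) := by
    apply antitone_nat_of_succ_le
    intro l
    have h1 := hmono l
    have h2 : ⟪g (ξ l), d l⟫ ≤ 0 := (hgd0 l).trans (by simp only [neg_nonpos]; positivity)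
    have h3 : γ * ρ ^ i l * ⟪g (ξ l), d l⟫ ≤ 0 :=
      mul_nonpos_of_nonneg_of_nonpos (by positivity) h2
    linarith
  -- bounded
  obtain ⟨R, hR⟩ : ∃ R, ∀ l, ‖ξ l - ξs‖ ≤ R := by
    refine ⟨2 * c * ‖g ξs‖ + 2 * c * (ψ (ξ 0) - ψ ξs) + 1, fun l => ?_⟩
    have h1 := hlow ξs (ξ l)
    have h2 : ψ (ξ l) ≤ ψ (ξ 0) := hanti (Nat.zero_le l)
    have h3 := neg_le_of_abs_le (abs_real_inner_le_norm (g ξs) (ξ l - ξs))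
    have h4 := hmin' (ξ 0)
    set r := ‖ξ l - ξs‖ with hr
    set G := ‖g ξs‖
    have hr0 : 0 ≤ r := norm_nonneg _
    have hG0 : 0 ≤ G := norm_nonneg _
    have h5 : 1 / (2 * c) * r ^ 2 ≤ G * r + (ψ (ξ 0) - ψ ξs) := by linarith
    have h6 : r ^ 2 ≤ 2 * c * G * r + 2 * c * (ψ (ξ 0) - ψ ξs) := by
      have := mul_le_mul_of_nonneg_left h5 (by positivity : 0 ≤ 2 * c)
      have e : 2 * c * (1 / (2 * c) * r ^ 2) = r ^ 2 := by field_simp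
      rw [e] at this; linarith
    have hD : 0 ≤ 2 * c * (ψ (ξ 0) - ψ ξs) := mul_nonneg (by positivity) (by linarith)
    by_contra hlt
    push Not at hlt
    have hr1 : 1 ≤ r := by nlinarith [mul_nonneg hc.le hG0]
    have h7 : 2 * c * (ψ (ξ 0) - ψ ξs) ≤ 2 * c * (ψ (ξ 0) - ψ ξs) * r := le_mul_of_one_le_right hD hr1
    have h8 := mul_lt_mul_of_pos_right hlt (by linarith : 0 < r)
    nlinarith
  have hball : ∀ l, ξ l ∈ Metric.closedBall ξs R := fun l => by
    rw [mem_closedBall_iff_norm]; exact hR l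
  refine ⟨Metric.isBounded_closedBall.subset (range_subset_iff.mpr hball), ?_⟩
  have hR0 : 0 ≤ R := (norm_nonneg _).trans (hR 0)
  obtain ⟨G, hG⟩ := (isCompact_closedBall ξs R).exists_bound_of_continuousOn hGc.continuousOn
  have hG0 : 0 ≤ G := (norm_nonneg _).trans (hG _ (hball 0))
  have hdb : ∀ l, ‖d l‖ ≤ c * G := by
    intro l
    have h1 := hgd0 l
    have h2 := neg_le_of_abs_le (abs_real_inner_le_norm (g (ξ l)) (d l))
    have h3 := hG _ (hball l)
    have h5 : c⁻¹ * ‖d l‖ ^ 2 ≤ G * ‖d l‖ := by nlinarith [norm_nonneg (d l)]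
    rcases (norm_nonneg (d l)).eq_or_lt with h | h
    · rw [← h]; positivity
    · have h6 : c⁻¹ * ‖d l‖ ≤ G := by
        apply le_of_mul_le_mul_right _ h
        linarith
      rwa [inv_mul_le_iff₀ hc] at h6
  set R2 := R + c * G with hR2
  obtain ⟨H, hH⟩ := (isCompact_closedBall ξs R2).exists_bound_of_continuousOn hHc.continuousOn
  have hsub : Metric.closedBall ξs R ⊆ Metric.closedBall ξs R2 :=
    Metric.closedBall_subset_closedBall (by rw [hR2]; nlinarith [mul_nonneg hc.le hG0])
  have hH0 : 0 ≤ H := (norm_nonneg _).trans (hH _ (hsub (hball 0)))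
  have hfup : ∀ z ∈ Metric.closedBall ξs R2, ∀ y ∈ Metric.closedBall ξs R2,
      f y ≤ f z + ⟪gradient f z, y - z⟫ + H * ‖y - z‖ ^ 2 := by
    intro z hz y hy
    have h1 := convex_first hfd hfconv y z
    have h2 := (convex_closedBall ξs R2).norm_image_sub_le_of_norm_fderiv_le
      (fun w _ => hgd w) hH hz hy
    have h3 := real_inner_le_norm (gradient f y - gradient f z) (y - z)
    have h4 := mul_le_mul_of_nonneg_right h2 (norm_nonneg (y - z))
    have e : z - y = -(y - z) := by abel
    rw [e, inner_neg_right] at h1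
    rw [inner_sub_left] at h3
    linarith [sq (‖y - z‖)]
  set M := H + c / 2 * ‖E‖ ^ 2 + 1 / (2 * c) with hM
  have hM0 : 0 < M := by positivity
  -- step lower bound
  have harm : ∀ l j, ρ ^ j * M ≤ c⁻¹ * (1 - γ) →
      ψ (ξ l + ρ ^ j • d l) ≤ ψ (ξ l) + γ * ρ ^ j * ⟪g (ξ l), d l⟫ := by
    intro l j hj
    have hρj : 0 < ρ ^ j := by positivity
    have hρj1 : ρ ^ j ≤ 1 := pow_le_one₀ hρ0.le hρ.2.le
    have hy : ξ l + ρ ^ j • d l ∈ Metric.closedBall ξs R2 := by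
      rw [mem_closedBall_iff_norm]
      have e : ξ l + ρ ^ j • d l - ξs = (ξ l - ξs) + ρ ^ j • d l := by abel
      rw [e]
      refine (norm_add_le _ _).trans (add_le_add (hR l) ?_)
      rw [norm_smul, Real.norm_of_nonneg hρj.le]
      exact (mul_le_of_le_one_left (norm_nonneg _) hρj1).trans (hdb l)
    have h1 := hup (ξ l) _ H (hfup _ (hsub (hball l)) _ hy)
    rw [add_sub_cancel_left, inner_smul_right, norm_smul, Real.norm_of_nonneg hρj.le] at h1
    have h2 := hgd0 l
    have h3 : ρ ^ j * M * ‖d l‖ ^ 2 ≤ c⁻¹ * (1 - γ) * ‖d l‖ ^ 2 :=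
      mul_le_mul_of_nonneg_right hj (sq_nonneg _)
    have h4 : (1 - γ) * ⟪g (ξ l), d l⟫ ≤ (1 - γ) * - (c⁻¹ * ‖d l‖ ^ 2) :=
      mul_le_mul_of_nonneg_left h2 (by linarith [hγ.2])
    have h5 : ρ ^ j * (ρ ^ j * M * ‖d l‖ ^ 2 + (1 - γ) * ⟪g (ξ l), d l⟫) ≤ 0 :=
      mul_nonpos_of_nonneg_of_nonpos hρj.le (by linarith)
    have h6 : M * (ρ ^ j * ‖d l‖) ^ 2 = ρ ^ j * (ρ ^ j * M * ‖d l‖ ^ 2) := by ring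
    rw [h6] at h1
    linarith
  obtain ⟨N, hN⟩ : ∃ N : ℕ, ρ ^ N < c⁻¹ * (1 - γ) / M :=
    exists_pow_lt_of_lt_one (div_pos (mul_pos hci (by linarith [hγ.2])) hM0) hρ.2
  have hiN : ∀ l, i l ≤ N := by
    intro l
    by_contra hlt
    push Not at hlt
    exact (hi l).2 N hlt (harm l N ((lt_div_iff₀ hM0).mp hN).le)
  have hstepN : ∀ l, ρ ^ N ≤ ρ ^ i l := fun l =>
    pow_le_pow_of_le_one hρ0.le hρ.2.le (hiN l)
  -- gradient bound
  set K := H + (c⁻¹ + c * ‖E‖ ^ 2) with hK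
  have hK0 : 0 < K := by positivity
  have hgV : ∀ l, ‖g (ξ l)‖ ^ 2 ≤ K * ⟪d l, V l (d l)⟫ := by
    intro l
    have := symm_bound (hVsym l) (fun u => le_trans (by positivity) (hVd l u)) hK0 (fun u => by
      refine (hVup l u).trans ?_
      have h1 := real_inner_le_norm u (fderiv ℝ (gradient f) (ξ l) u)
      have h2 := (fderiv ℝ (gradient f) (ξ l)).le_of_opNorm_le (hH _ (hsub (hball l))) u
      have h3 := mul_le_mul_of_nonneg_left h2 (norm_nonneg u)
      simp only [ContinuousLinearMap.add_apply, ContinuousLinearMap.smul_apply,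
        ContinuousLinearMap.id_apply, inner_add_right, inner_smul_right,
        real_inner_self_eq_norm_sq]
      rw [hK]
      linarith [sq ‖u‖]) (d l)
    rwa [hd l, norm_neg, ← hd l] at this
  have hxg : ∀ l, ‖ξ l - ξs‖ ≤ 2 * c * ‖g (ξ l)‖ := by
    intro l
    have h1 := hlow (ξ l) ξs
    have h2 := hmin' (ξ l)
    have h3 := neg_le_of_abs_le (abs_real_inner_le_norm (g (ξ l)) (ξs - ξ l))
    rw [norm_sub_rev ξs] at h1 h3
    have h5 : 1 / (2 * c) * ‖ξ l - ξs‖ ^ 2 ≤ ‖g (ξ l)‖ * ‖ξ l - ξs‖ := by linarith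
    rcases (norm_nonneg (ξ l - ξs)).eq_or_lt with h | h
    · rw [← h]; positivity
    · have h6 : 1 / (2 * c) * ‖ξ l - ξs‖ ≤ ‖g (ξ l)‖ := by
        apply le_of_mul_le_mul_right _ h
        linarith
      rwa [one_div, inv_mul_le_iff₀ (by positivity)] at h6
  -- convergence
  have hdec : ∀ l, ‖ξ l - ξs‖ ^ 2 ≤
      (4 * c ^ 2 * K / (γ * ρ ^ N)) * (ψ (ξ l) - ψ (ξ (l + 1))) := by
    intro l
    have h1 := hmono l
    rw [hgd' l] at h1
    have hq : 0 ≤ ⟪d l, V l (d l)⟫ := le_trans (by positivity) (hVd l (d l))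
    have h2 := mul_le_mul_of_nonneg_right (hstepN l) hq
    have h3 : γ * (ρ ^ N * ⟪d l, V l (d l)⟫) ≤ γ * (ρ ^ i l * ⟪d l, V l (d l)⟫) :=
      mul_le_mul_of_nonneg_left h2 hγ0.le
    have h4 : γ * ρ ^ N * ⟪d l, V l (d l)⟫ ≤ ψ (ξ l) - ψ (ξ (l + 1)) := by linarith
    have h5 : ‖ξ l - ξs‖ ^ 2 ≤ (2 * c * ‖g (ξ l)‖) ^ 2 :=
      pow_le_pow_left₀ (norm_nonneg _) (hxg l) 2
    have hP : 0 < γ * ρ ^ N := by positivity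
    rw [div_mul_eq_mul_div, le_div_iff₀ hP]
    calc ‖ξ l - ξs‖ ^ 2 * (γ * ρ ^ N) ≤ (2 * c * ‖g (ξ l)‖) ^ 2 * (γ * ρ ^ N) := by gcongr
      _ = 4 * c ^ 2 * (γ * ρ ^ N) * ‖g (ξ l)‖ ^ 2 := by ring
      _ ≤ 4 * c ^ 2 * (γ * ρ ^ N) * (K * ⟪d l, V l (d l)⟫) := by gcongr; exact hgV l
      _ = 4 * c ^ 2 * K * (γ * ρ ^ N * ⟪d l, V l (d l)⟫) := by ring
      _ ≤ _ := by gcongr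
  have hlim := tendsto_atTop_ciInf hanti ⟨ψ ξs, by rintro _ ⟨l, rfl⟩; exact hmin' _⟩
  have hdiff := ((hlim.sub (hlim.comp (tendsto_add_atTop_nat 1))).const_mul
    (4 * c ^ 2 * K / (γ * ρ ^ N)))
  rw [sub_self, mul_zero] at hdiff
  have hsq := squeeze_zero (fun l => sq_nonneg ‖ξ l - ξs‖) hdec hdiff
  rw [tendsto_iff_norm_sub_tendsto_zero]
  have := hsq.sqrt
  simpa using this
end
end
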